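/- arXiv:1707.00148 — 2 statements merged into one kernel-verified Lean document; each statement's English description precedes it below -/
import Mathlib

section
/- Let H be a linear subspace of the Hilbert space L2 of square-integrable functions from [0,∞) to ℝⁿ such that S_τ H ⊆ H for every τ ≥ 0, where S_τ is the right-shift operator. Let Φ₀ and Φ₁ be symmetric n×n real matrices and define quadratic forms σᵢ : H → ℝ by σᵢ(f) = ⟨f, Φᵢ f⟩ (the L2 inner product of f with the pointwise application of Φᵢ to f), for i = 0, 1. Suppose there exists f* ∈ H with σ₁(f*) > 0. Then the following are equivalent: (i) σ₀(f) ≤ 0 for all f ∈ H with σ₁(f) ≥ 0; (ii) there exists μ ≥ 0 such that σ₀(f) + μ σ₁(f) ≤ 0 for all f ∈ H. -/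
open MeasureTheory Set

noncomputable section

/-- Signals: functions from time `[0,∞)` (modeled as `ℝ`, with everything measured on `Ioi 0`)
to `ℝⁿ`. -/
abbrev Signal (n : ℕ) : Type := ℝ → Fin n → ℝ

/-- Membership in `L₂`: square integrability on `[0,∞)`. -/
def memL2 {n : ℕ} (v : Signal n) : Prop :=
  MemLp v 2 (volume.restrict (Ioi (0:ℝ)))

/-- The `L₂` inner product `⟨v,w⟩ = ∫₀^∞ v(t)ᵀ w(t) dt`. -/
def ip {n : ℕ} (v w : Signal n) : ℝ :=
  ∫ t in Ioi (0:ℝ), ∑ i, v t i * w t i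

/-- Squared `L₂`-norm `‖v‖₂²`. -/
def normSq {n : ℕ} (v : Signal n) : ℝ := ip v v

/-- The `L₂`-norm `‖v‖₂`. -/
def l2norm {n : ℕ} (v : Signal n) : ℝ := Real.sqrt (normSq v)

/-- Truncation operator `P_T`. -/
def trunc {n : ℕ} (T : ℝ) (v : Signal n) : Signal n :=
  fun t => if t ≤ T then v t else 0

/-- Right-shift operator `S_τ`. -/
def rshift {n : ℕ} (τ : ℝ) (v : Signal n) : Signal n :=
  fun t => if τ ≤ t then v (t - τ) else 0

/-- Membership in the extended space `L₂ₑ`: every truncation is in `L₂`. -/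
def memL2e {n : ℕ} (v : Signal n) : Prop := ∀ T : ℝ, memL2 (trunc T v)

/-- A system is an input-output map with `Σ(0) = 0`. -/
def IsSystem {n : ℕ} (F : Signal n → Signal n) : Prop := F 0 = 0

/-- Causality: `P_T Σ P_T = P_T Σ` for all `T ≥ 0`. -/
def IsCausal {n : ℕ} (F : Signal n → Signal n) : Prop :=
  ∀ T ≥ (0:ℝ), ∀ u : Signal n, trunc T (F (trunc T u)) = trunc T (F u)

/-- Boundedness: `F` maps `L₂` into `L₂`. -/
def IsBoundedSys {n : ℕ} (F : Signal n → Signal n) : Prop :=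
  ∀ u : Signal n, memL2 u → memL2 (F u)

/-- Linearity of an input-output map. -/
def IsLinearSys {n : ℕ} (F : Signal n → Signal n) : Prop :=
  ∀ (c : ℝ) (u v : Signal n), F (c • u + v) = c • F u + F v

/-- Time invariance: `F` commutes with all right shifts. -/
def TimeInvariant {n : ℕ} (F : Signal n → Signal n) : Prop :=
  ∀ τ ≥ (0:ℝ), ∀ u : Signal n, F (rshift τ u) = rshift τ (F u)

/-- Passivity for a general (not necessarily bounded) system:
`∫₀ᵀ u(t)ᵀ (F u)(t) dt ≥ 0` for all `u ∈ L₂ₑ` and `T > 0`. -/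
def PassiveTrunc {n : ℕ} (F : Signal n → Signal n) : Prop :=
  ∀ u : Signal n, memL2e u → ∀ T > (0:ℝ), 0 ≤ ip (trunc T u) (trunc T (F u))

/-- Passivity for a bounded causal system: `⟨u, F u⟩ ≥ 0` for all `u ∈ L₂`. -/
def PassiveL2 {n : ℕ} (F : Signal n → Signal n) : Prop :=
  ∀ u : Signal n, memL2 u → 0 ≤ ip u (F u)

/-- Strict passivity for a bounded causal system. -/
def StrictlyPassive {n : ℕ} (F : Signal n → Signal n) : Prop :=
  ∃ δ > (0:ℝ), ∃ ε > (0:ℝ), ∀ u : Signal n, memL2 u →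
    δ * normSq u + ε * normSq (F u) ≤ ip u (F u)

/-- Output strict passivity for a bounded causal system. -/
def OutputStrictlyPassive {n : ℕ} (F : Signal n → Signal n) : Prop :=
  ∃ ε > (0:ℝ), ∀ u : Signal n, memL2 u →
    ε * normSq (F u) ≤ ip u (F u)

/-- `F` has `L₂`-gain `≤ γ`. -/
def HasGainLe {n : ℕ} (γ : ℝ) (F : Signal n → Signal n) : Prop :=
  ∀ u : Signal n, memL2e u → ∀ T ≥ (0:ℝ),
    l2norm (trunc T (F u)) ≤ γ * l2norm (trunc T u)

end

noncomputable section

/-- The quadratic form `σ(f) = ⟨f, Φ f⟩` on `L₂` associated with a symmetric matrix `Φ`. -/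
def quadForm {n : ℕ} (Φ : Matrix (Fin n) (Fin n) ℝ) (f : Signal n) : ℝ :=
  ∫ t in Ioi (0:ℝ), ∑ i, f t i * Φ.mulVec (f t) i

/-- scalar shift -/
def sh (τ : ℝ) (v : ℝ → ℝ) : ℝ → ℝ := fun t => if τ ≤ t then v (t - τ) else 0

lemma sh_integral (τ : ℝ) (hτ : 0 ≤ τ) (F : ℝ → ℝ) :
    ∫ t in Ioi (0:ℝ), sh τ F t = ∫ t in Ioi (0:ℝ), F t := by
  rw [← integral_indicator measurableSet_Ioi, ← integral_indicator measurableSet_Ioi,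
    ← integral_sub_right_eq_self ((Ioi (0:ℝ)).indicator F) τ]
  apply integral_congr_ae
  have h : ∀ᵐ t : ℝ, t ≠ τ := by
    simp [ae_iff]
  filter_upwards [h] with t ht
  simp only [indicator, sh, mem_Ioi]
  rcases lt_or_gt_of_ne ht with h | h
  · rw [if_neg (not_le.2 h), if_neg (by linarith : ¬ (0 < t - τ))]
    simp
  · rw [if_pos (by linarith), if_pos h.le, if_pos (by linarith)]

lemma sh_mul (τ : ℝ) (u v : ℝ → ℝ) (t : ℝ) :
    sh τ u t * sh τ v t = sh τ (fun s => u s * v s) t := by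
  unfold sh; split_ifs <;> simp

lemma tail_tendsto (u : ℝ → ℝ) (hu : IntegrableOn u (Ioi 0)) :
    Filter.Tendsto (fun τ : ℝ => ∫ t in Ioi (0:ℝ), (Ici τ).indicator u t) Filter.atTop (nhds 0) := by
  have : (0:ℝ) = ∫ t in Ioi (0:ℝ), (0:ℝ) := by simp
  rw [show nhds (0:ℝ) = nhds (∫ t in Ioi (0:ℝ), (0:ℝ)) by rw [← this]]
  apply tendsto_integral_filter_of_dominated_convergence (fun t => ‖u t‖)
  · exact Filter.Eventually.of_forall fun τ => hu.1.indicator measurableSet_Ici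
  · exact Filter.Eventually.of_forall fun τ => Filter.Eventually.of_forall fun t =>
      norm_indicator_le_norm_self _ _
  · exact hu.norm
  · refine Filter.Eventually.of_forall fun t => ?_
    apply tendsto_const_nhds.congr'
    filter_upwards [Filter.eventually_gt_atTop t] with τ hτ
    simp [indicator, hτ]

lemma cross_tendsto (u v : ℝ → ℝ) (hu : MemLp u 2 (volume.restrict (Ioi (0:ℝ))))
    (hv : ∀ τ ≥ (0:ℝ), MemLp (sh τ v) 2 (volume.restrict (Ioi (0:ℝ)))) :
    Filter.Tendsto (fun τ : ℝ => ∫ t in Ioi (0:ℝ), u t * sh τ v t) Filter.atTop (nhds 0) := by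
  have h1 := tail_tendsto (fun t => u t ^ 2) hu.integrable_sq
  have h2 : Filter.Tendsto (fun τ : ℝ => (∫ t in Ioi (0:ℝ), (Ici τ).indicator (fun t => u t ^ 2) t) ^ (1/(2:ℝ)) *
      (∫ t in Ioi (0:ℝ), v t ^ 2) ^ (1/(2:ℝ))) Filter.atTop (nhds 0) := by
    have := (h1.rpow_const (p := 1/(2:ℝ)) (Or.inr (by norm_num))).mul_const
      ((∫ t in Ioi (0:ℝ), v t ^ 2) ^ (1/(2:ℝ)))
    simpa using this
  apply squeeze_zero_norm' _ h2
  filter_upwards [Filter.eventually_ge_atTop (0:ℝ)] with τ hτ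
  have hI : MemLp ((Ici τ).indicator u) (ENNReal.ofReal 2) (volume.restrict (Ioi (0:ℝ))) := by
    simpa using hu.indicator measurableSet_Ici
  have hV : MemLp (sh τ v) (ENNReal.ofReal 2) (volume.restrict (Ioi (0:ℝ))) := by
    simpa using hv τ hτ
  have key := integral_mul_norm_le_Lp_mul_Lq (Real.HolderConjugate.two_two) hI hV
  have e1 : ∀ t, ‖(Ici τ).indicator u t‖ * ‖sh τ v t‖ = ‖u t * sh τ v t‖ := by
    intro t
    rw [norm_mul]
    by_cases h : τ ≤ t <;> simp [sh, indicator, h]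
  have e2 : ∀ t, ‖(Ici τ).indicator u t‖ ^ (2:ℝ) = (Ici τ).indicator (fun t => u t ^ 2) t := by
    intro t
    by_cases h : τ ≤ t <;> simp [indicator, h]
  have e3 : ∀ t, ‖sh τ v t‖ ^ (2:ℝ) = sh τ (fun t => v t ^ 2) t := by
    intro t
    by_cases h : τ ≤ t <;> simp [sh, h]
  simp only [e1, e2, e3] at key
  rw [sh_integral τ hτ] at key
  exact (norm_integral_le_integral_norm _).trans key

lemma memL2_comp {n : ℕ} {f : Signal n} (hf : memL2 f) (i : Fin n) :
    MemLp (fun t => f t i) 2 (volume.restrict (Ioi (0:ℝ))) :=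
  (memLp_pi_iff.1 hf) i

lemma quadForm_eq {n : ℕ} (Φ : Matrix (Fin n) (Fin n) ℝ) (f : Signal n) (hf : memL2 f) :
    quadForm Φ f = ∑ i, ∑ j, Φ i j * ∫ t in Ioi (0:ℝ), f t i * f t j := by
  have hint : ∀ i j, Integrable (fun t => f t i * f t j) (volume.restrict (Ioi (0:ℝ))) :=
    fun i j => (memL2_comp hf i).integrable_mul (memL2_comp hf j)
  unfold quadForm
  simp_rw [← integral_const_mul]
  rw [← Finset.sum_congr rfl fun i _ =>
    integral_finsetSum Finset.univ fun j _ => (hint i j).const_mul (Φ i j),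
    ← integral_finsetSum Finset.univ fun i _ =>
      integrable_finsetSum Finset.univ fun j _ => (hint i j).const_mul (Φ i j)]
  congr 1; ext t
  simp only [Matrix.mulVec, dotProduct, Finset.mul_sum]
  refine Finset.sum_congr rfl fun i _ => Finset.sum_congr rfl fun j _ => by ring

lemma quadForm_smul {n : ℕ} (Φ : Matrix (Fin n) (Fin n) ℝ) (c : ℝ) (f : Signal n) :
    quadForm Φ (c • f) = c ^ 2 * quadForm Φ f := by
  unfold quadForm
  rw [← integral_const_mul]
  congr 1; ext t
  simp only [Pi.smul_apply, Matrix.mulVec_smul, smul_eq_mul, Finset.mul_sum]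
  refine Finset.sum_congr rfl fun i _ => by ring

lemma quadForm_tendsto {n : ℕ} (Φ : Matrix (Fin n) (Fin n) ℝ) (f g : Signal n)
    (hf : memL2 f) (hg : memL2 g) (hgs : ∀ τ ≥ (0:ℝ), memL2 (rshift τ g)) :
    Filter.Tendsto (fun τ : ℝ => quadForm Φ (f + rshift τ g)) Filter.atTop
      (nhds (quadForm Φ f + quadForm Φ g)) := by
  have hr : ∀ τ t i, rshift τ g t i = sh τ (fun s => g s i) t := by
    intro τ t i; unfold rshift sh; split_ifs <;> rfl
  have hsc : ∀ i, ∀ τ ≥ (0:ℝ), MemLp (sh τ (fun s => g s i)) 2 (volume.restrict (Ioi (0:ℝ))) := by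
    intro i τ hτ
    have := memL2_comp (hgs τ hτ) i
    simpa only [hr] using this
  have hlim : Filter.Tendsto (fun τ : ℝ => ∑ i, ∑ j, Φ i j *
      ((∫ t in Ioi (0:ℝ), f t i * f t j) + (∫ t in Ioi (0:ℝ), f t i * sh τ (fun s => g s j) t)
       + (∫ t in Ioi (0:ℝ), f t j * sh τ (fun s => g s i) t)
       + ∫ t in Ioi (0:ℝ), g t i * g t j)) Filter.atTop
      (nhds (∑ i, ∑ j, Φ i j * ((∫ t in Ioi (0:ℝ), f t i * f t j) + 0 + 0
        + ∫ t in Ioi (0:ℝ), g t i * g t j))) := by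
    refine tendsto_finsetSum _ fun i _ => tendsto_finsetSum _ fun j _ => ?_
    exact (((tendsto_const_nhds.add (cross_tendsto _ _ (memL2_comp hf i) (hsc j))).add
      (cross_tendsto _ _ (memL2_comp hf j) (hsc i))).add tendsto_const_nhds).const_mul _
  have e : quadForm Φ f + quadForm Φ g = ∑ i, ∑ j, Φ i j * ((∫ t in Ioi (0:ℝ), f t i * f t j) + 0 + 0
        + ∫ t in Ioi (0:ℝ), g t i * g t j) := by
    rw [quadForm_eq Φ f hf, quadForm_eq Φ g hg]
    simp only [← Finset.sum_add_distrib, mul_add, add_zero]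
  rw [e]
  apply hlim.congr'
  filter_upwards [Filter.eventually_ge_atTop (0:ℝ)] with τ hτ
  rw [quadForm_eq Φ _ (MemLp.add hf (hgs τ hτ))]
  refine Finset.sum_congr rfl fun i _ => Finset.sum_congr rfl fun j _ => ?_
  congr 1
  have i1 := (memL2_comp hf i).integrable_mul (memL2_comp hf j)
  have i2 := (memL2_comp hf i).integrable_mul (hsc j τ hτ)
  have i3 := (memL2_comp hf j).integrable_mul (hsc i τ hτ)
  have i4 := (hsc i τ hτ).integrable_mul (hsc j τ hτ)
  rw [← sh_integral τ hτ (fun t => g t i * g t j)]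
  simp_rw [← sh_mul]
  have a1 := integral_add i1 i2
  have a2 := integral_add (i1.add i2) i3
  have a3 := integral_add ((i1.add i2).add i3) i4
  simp only [Pi.add_apply, Pi.mul_apply] at a1 a2 a3
  rw [← a1, ← a2, ← a3]
  congr 1; ext t
  simp only [Pi.add_apply, hr]
  ring

lemma key_ineq {n : ℕ} (H : Submodule ℝ (Signal n))
    (hHL2 : ∀ f ∈ H, memL2 f)
    (hHshift : ∀ τ ≥ (0:ℝ), ∀ f ∈ H, rshift τ f ∈ H)
    (Φ₀ Φ₁ : Matrix (Fin n) (Fin n) ℝ)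
    (h : ∀ f ∈ H, 0 ≤ quadForm Φ₁ f → quadForm Φ₀ f ≤ 0)
    (f g : Signal n) (hf : f ∈ H) (hg : g ∈ H)
    (hs : 0 < quadForm Φ₁ f + quadForm Φ₁ g) : quadForm Φ₀ f + quadForm Φ₀ g ≤ 0 := by
  have T := fun Φ => quadForm_tendsto Φ f g (hHL2 f hf) (hHL2 g hg)
    fun τ hτ => hHL2 _ (hHshift τ hτ g hg)
  refine le_of_tendsto (T Φ₀) ?_
  filter_upwards [(T Φ₁).eventually (lt_mem_nhds hs), Filter.eventually_ge_atTop (0:ℝ)] with τ h1 h2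
  exact h _ (H.add_mem hf (hHshift τ h2 g hg)) h1.le

/-- **S-procedure lossless theorem** (Proposition 1). -/
theorem s_procedure_lossless {n : ℕ} (H : Submodule ℝ (Signal n))
    (hHL2 : ∀ f ∈ H, memL2 f)
    (hHshift : ∀ τ ≥ (0:ℝ), ∀ f ∈ H, rshift τ f ∈ H)
    (Φ₀ Φ₁ : Matrix (Fin n) (Fin n) ℝ) (hΦ₀ : Φ₀.IsSymm) (hΦ₁ : Φ₁.IsSymm)
    (hex : ∃ fstar ∈ H, 0 < quadForm Φ₁ fstar) :
    (∀ f ∈ H, 0 ≤ quadForm Φ₁ f → quadForm Φ₀ f ≤ 0) ↔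
      (∃ μ ≥ (0:ℝ), ∀ f ∈ H, quadForm Φ₀ f + μ * quadForm Φ₁ f ≤ 0) := by
  constructor
  · intro h
    obtain ⟨fs, hfs, hpos⟩ := hex
    set S : Set ℝ := {x | ∃ f ∈ H, 0 < quadForm Φ₁ f ∧ x = -quadForm Φ₀ f / quadForm Φ₁ f} with hS
    have hne : S.Nonempty := ⟨_, fs, hfs, hpos, rfl⟩
    have hlb : ∀ x ∈ S, 0 ≤ x := by
      rintro x ⟨f, hf, hp, rfl⟩
      exact div_nonneg (by linarith [h f hf hp.le]) hp.le
    refine ⟨sInf S, le_csInf hne hlb, fun g hg => ?_⟩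
    rcases lt_trichotomy (quadForm Φ₁ g) 0 with hn | hz | hp
    · have : quadForm Φ₀ g / (-quadForm Φ₁ g) ≤ sInf S := by
        apply le_csInf hne
        rintro x ⟨f, hf, hp, rfl⟩
        rw [div_le_div_iff₀ (by linarith) hp]
        have hε : ∀ ε > (0:ℝ), (-quadForm Φ₁ g + ε) * quadForm Φ₀ f
            + quadForm Φ₁ f * quadForm Φ₀ g ≤ 0 := by
          intro ε hε
          have k := key_ineq H hHL2 hHshift Φ₀ Φ₁ h (Real.sqrt (-quadForm Φ₁ g + ε) • f)
            (Real.sqrt (quadForm Φ₁ f) • g) (H.smul_mem _ hf) (H.smul_mem _ hg)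
          simp only [quadForm_smul] at k
          rw [Real.sq_sqrt hp.le, Real.sq_sqrt (by linarith)] at k
          exact k (by nlinarith)
        have : Filter.Tendsto (fun ε : ℝ => (-quadForm Φ₁ g + ε) * quadForm Φ₀ f
            + quadForm Φ₁ f * quadForm Φ₀ g) (nhdsWithin 0 (Ioi 0))
            (nhds ((-quadForm Φ₁ g + 0) * quadForm Φ₀ f
            + quadForm Φ₁ f * quadForm Φ₀ g)) := by
          apply Filter.Tendsto.mono_left _ nhdsWithin_le_nhds
          apply Continuous.tendsto
          fun_prop
        have := le_of_tendsto this (by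
          filter_upwards [self_mem_nhdsWithin] with ε h using hε ε h)
        nlinarith
      rw [div_le_iff₀ (by linarith)] at this
      nlinarith
    · rw [hz]; simpa using h g hg hz.ge
    · have : sInf S ≤ -quadForm Φ₀ g / quadForm Φ₁ g :=
        csInf_le ⟨0, hlb⟩ ⟨g, hg, hp, rfl⟩
      rw [le_div_iff₀ hp] at this
      linarith
  · rintro ⟨μ, hμ, h⟩ f hf h1
    have := h f hf
    nlinarith [mul_nonneg hμ h1]

end
end

section
/- Let Σ₁ be a bounded causal strictly passive system with passivity constant ε > 0 (i.e. ⟨u, Σ₁(u)⟩ ≥ ε(‖u‖₂² + ‖Σ₁(u)‖₂²) for all u ∈ L2) and let Σ₂ be a bounded causal passive system. Then for any L2 signals satisfying the feedback equations u₁ = e₁ − y₂, u₂ = e₂ + y₁, y₁ = Σ₁(u₁), y₂ = Σ₂(u₂), one has ‖y‖₂ ≤ (2 + 1/ε)‖e‖₂, where y = (y₁,y₂) and e = (e₁,e₂); in particular the closed-loop system Σ₁ ‖ Σ₂ has L2-gain at most 2 + 1/ε from (e₁,e₂) to (y₁,y₂). -/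
open MeasureTheory Set

theorem ip_integrable_aux {n : ℕ} {v w : Signal n} (hv : memL2 v) (hw : memL2 w) :
    Integrable (fun t => ∑ i, v t i * w t i) (volume.restrict (Ioi (0:ℝ))) := by
  refine integrable_finsetSum _ fun i _ => ?_
  have h1 : MemLp (fun t => v t i) 2 (volume.restrict (Ioi (0:ℝ))) := MemLp.eval hv i
  have h2 : MemLp (fun t => w t i) 2 (volume.restrict (Ioi (0:ℝ))) := MemLp.eval hw i
  exact MemLp.integrable_mul h1 h2

theorem ip_comm_aux {n : ℕ} (v w : Signal n) : ip v w = ip w v := by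
  unfold ip
  simp only [mul_comm]

theorem ip_add_aux {n : ℕ} {v w z : Signal n} (hv : memL2 v) (hw : memL2 w) (hz : memL2 z) :
    ip (v + w) z = ip v z + ip w z := by
  unfold ip
  rw [← integral_add (ip_integrable_aux hv hz) (ip_integrable_aux hw hz)]
  simp only [Pi.add_apply, add_mul, Finset.sum_add_distrib]

theorem ip_smul_aux {n : ℕ} (c : ℝ) (v z : Signal n) :
    ip (c • v) z = c * ip v z := by
  unfold ip
  rw [← integral_const_mul]
  simp only [Pi.smul_apply, smul_eq_mul, Finset.mul_sum, mul_assoc]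

theorem normSq_nonneg_aux {n : ℕ} (v : Signal n) : 0 ≤ normSq v :=
  integral_nonneg fun t => Finset.sum_nonneg fun i _ => mul_self_nonneg _

theorem memL2_smul_aux {n : ℕ} {v : Signal n} (c : ℝ) (hv : memL2 v) : memL2 (c • v) :=
  MemLp.const_smul hv c

theorem memL2_add_aux {n : ℕ} {v w : Signal n} (hv : memL2 v) (hw : memL2 w) : memL2 (v + w) :=
  MemLp.add hv hw

theorem normSq_comb_aux {n : ℕ} {v w : Signal n} (s : ℝ) (hv : memL2 v) (hw : memL2 w) :
    normSq (s • v + w) = s ^ 2 * normSq v + 2 * s * ip v w + normSq w := by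
  have hs := memL2_smul_aux s hv
  have h := memL2_add_aux hs hw
  unfold normSq
  rw [ip_add_aux hs hw h, ip_smul_aux, ip_comm_aux v (_ + _), ip_comm_aux w (_ + _),
    ip_add_aux hs hw hv, ip_add_aux hs hw hw, ip_smul_aux, ip_smul_aux, ip_comm_aux w v]
  ring

/-- Cauchy–Schwarz on pairs of signals. -/
theorem cs_aux {n : ℕ} {a b c d : Signal n} (ha : memL2 a) (hb : memL2 b) (hc : memL2 c)
    (hd : memL2 d) :
    |ip a c + ip b d| ≤ √(normSq a + normSq b) * √(normSq c + normSq d) := by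
  have hab : 0 ≤ normSq a + normSq b := add_nonneg (normSq_nonneg_aux a) (normSq_nonneg_aux b)
  have key : discrim (normSq a + normSq b) (2 * (ip a c + ip b d)) (normSq c + normSq d) ≤ 0 := by
    apply discrim_le_zero
    intro s
    have h1 := normSq_nonneg_aux (s • a + c)
    have h2 := normSq_nonneg_aux (s • b + d)
    rw [normSq_comb_aux s ha hc] at h1
    rw [normSq_comb_aux s hb hd] at h2
    nlinarith
  rw [← Real.sqrt_mul hab]
  apply Real.abs_le_sqrt
  unfold discrim at key
  nlinarith

/-- Quantitative sufficiency part of **Theorem 1**: a strictly passive system (with passivity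
constant `ε`) in feedback with a passive system gives a closed loop with `L₂`-gain at most
`2 + 1/ε` from `(e₁,e₂)` to `(y₁,y₂)`. -/
theorem passivity_sufficiency {n : ℕ} (Sig1 Sig2 : Signal n → Signal n) (ε : ℝ) (hε : 0 < ε)
    (hSig1sys : IsSystem Sig1) (hSig1b : IsBoundedSys Sig1) (hSig1c : IsCausal Sig1)
    (hSig1sp : ∀ u : Signal n, memL2 u →
      ε * (normSq u + normSq (Sig1 u)) ≤ ip u (Sig1 u))
    (hSig2sys : IsSystem Sig2) (hSig2b : IsBoundedSys Sig2) (hSig2c : IsCausal Sig2)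
    (hSig2p : PassiveL2 Sig2)
    (e₁ e₂ u₁ u₂ y₁ y₂ : Signal n)
    (he₁ : memL2 e₁) (he₂ : memL2 e₂) (hu₁ : memL2 u₁) (hu₂ : memL2 u₂)
    (hy₁ : memL2 y₁) (hy₂ : memL2 y₂)
    (hfb₁ : u₁ = e₁ - y₂) (hfb₂ : u₂ = e₂ + y₁)
    (hout₁ : y₁ = Sig1 u₁) (hout₂ : y₂ = Sig2 u₂) :
    Real.sqrt (normSq y₁ + normSq y₂) ≤ (2 + 1 / ε) * Real.sqrt (normSq e₁ + normSq e₂) := by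
  have hm1 : memL2 ((-1 : ℝ) • u₁) := memL2_smul_aux _ hu₁
  have hy2 : y₂ = (-1 : ℝ) • u₁ + e₁ := by rw [hfb₁]; simp
  have N2 : normSq y₂ = normSq u₁ - 2 * ip u₁ e₁ + normSq e₁ := by
    rw [hy2, normSq_comb_aux _ hu₁ he₁]; ring
  have A1 := hSig1sp u₁ hu₁
  have A2 := hSig2p u₂ hu₂
  rw [← hout₁] at A1
  rw [← hout₂, hfb₂, ip_add_aux he₂ hy₁ hy₂, ip_comm_aux e₂ y₂, ip_comm_aux y₁ y₂, hy2,
    ip_add_aux hm1 he₁ he₂, ip_add_aux hm1 he₁ hy₁, ip_smul_aux, ip_smul_aux] at A2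
  have hX := cs_aux he₁ he₂ hy₁ hm1
  have hZ := cs_aux he₁ he₂ he₂ he₁
  have hz : memL2 (0 : Signal n) := by
    have := memL2_smul_aux 0 hu₁
    rwa [zero_smul] at this
  have hV := cs_aux he₁ he₂ hu₁ (memL2_smul_aux 0 hu₁)
  have nm : normSq ((-1 : ℝ) • u₁) = normSq u₁ := by
    unfold normSq
    rw [ip_smul_aux, ip_comm_aux, ip_smul_aux]; ring
  have n0 : normSq ((0 : ℝ) • u₁) = 0 := by
    unfold normSq
    rw [ip_smul_aux, zero_mul]
  rw [nm, ip_comm_aux e₂ ((-1 : ℝ) • u₁), ip_smul_aux] at hX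
  rw [n0, ip_comm_aux e₂ ((0 : ℝ) • u₁), ip_smul_aux, zero_mul, add_zero, add_zero,
    ip_comm_aux e₁ u₁] at hV
  rw [add_comm (normSq e₂) (normSq e₁), ip_comm_aux e₂ e₁] at hZ
  have p1 := normSq_nonneg_aux e₁
  have p2 := normSq_nonneg_aux e₂
  have p3 := normSq_nonneg_aux u₁
  have p4 := normSq_nonneg_aux y₁
  have hmono : √(normSq u₁) ≤ √(normSq y₁ + normSq u₁) := Real.sqrt_le_sqrt (by linarith)
  have sE := Real.sq_sqrt (add_nonneg p1 p2)
  have sW := Real.sq_sqrt (add_nonneg p4 p3)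
  have E0 := Real.sqrt_nonneg (normSq e₁ + normSq e₂)
  have W0 := Real.sqrt_nonneg (normSq y₁ + normSq u₁)
  set E := √(normSq e₁ + normSq e₂)
  set W := √(normSq y₁ + normSq u₁)
  have hV2 : -(E * W) ≤ ip u₁ e₁ := by
    have := mul_le_mul_of_nonneg_left hmono E0
    have := (abs_le.1 hV).1
    linarith
  have hX2 := (abs_le.1 hX).2
  have hZ2 := (abs_le.1 hZ).2
  have main : ε * W ^ 2 ≤ E * W + E ^ 2 := by
    have : ip e₁ y₁ = ip e₁ y₁ := rfl
    nlinarith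
  have hW : W ≤ (1 + 1 / ε) * E := by
    by_contra hc
    push Not at hc
    have h1 : (ε + 1) * E < ε * W := by
      have := mul_lt_mul_of_pos_left hc hε
      have e : ε * ((1 + 1 / ε) * E) = (ε + 1) * E := by field_simp
      linarith
    have hEW : E ≤ W := by
      have : 0 ≤ 1 / ε * E := by positivity
      nlinarith
    have Wp : 0 < W := by
      rcases W0.lt_or_eq with h | h
      · exact h
      · rw [← h] at h1; nlinarith
    nlinarith [mul_lt_mul_of_pos_right h1 Wp, mul_le_mul_of_nonneg_left hEW E0,
      mul_nonneg hε.le (mul_nonneg E0 W0)]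
  have hfin : W + E ≤ (2 + 1 / ε) * E := by linarith
  refine le_trans ?_ hfin
  apply Real.sqrt_le_iff.2
  refine ⟨by positivity, ?_⟩
  nlinarith
end
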